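/- Let f and g be probability density functions on ℝ with cumulative distribution functions F and G, and let c : [0,1]² → [0,∞) be a copula density with ∫_{[0,1]²} |1 − c(u,v)| du dv < ∞. For s ∈ [0,1] define ε_s = | ∑_{k∈ℤ} ∫_ℝ f(u) g(s + k − u) ( 1 − c(F(u), G(s + k − u)) ) du |. Then for every ε > 0, the Lebesgue measure of the set { s ∈ [0,1] : ε_s ≥ ε } is at most ( ∫_{[0,1]²} |1 − c(u,v)| du dv ) / ε. -/

import Mathlib

open MeasureTheory

lemma aux_cdf_cont (f : ℝ → ℝ) (hfi : Integrable f)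
    (F : ℝ → ℝ) (hF : ∀ x, F x = ∫ u in Set.Iic x, f u) : Continuous F := by
  have h : F = fun x => F 0 + ∫ u in (0:ℝ)..x, f u := by
    funext x
    rw [← intervalIntegral.integral_Iic_sub_Iic hfi.integrableOn hfi.integrableOn, ← hF, ← hF]
    ring
  rw [h]
  exact continuous_const.add (intervalIntegral.continuous_primitive
    (fun a b => hfi.intervalIntegrable) 0)

lemma aux_integrable (f : ℝ → ℝ) (hf1 : ∫ x, f x = 1) : Integrable f := by
  by_contra h
  rw [integral_undef h] at hf1
  exact zero_ne_one hf1

lemma aux_pit (f : ℝ → ℝ) (hf : Measurable f) (hf0 : ∀ x, 0 ≤ f x)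
    (hf1 : ∫ x, f x = 1) (F : ℝ → ℝ) (hF : ∀ x, F x = ∫ u in Set.Iic x, f u) :
    Measure.map F (volume.withDensity (fun x => ENNReal.ofReal (f x)))
      = volume.restrict (Set.Icc (0:ℝ) 1) := by
  have hfi := aux_integrable f hf1
  have hFc := aux_cdf_cont f hfi F hF
  set μ := volume.withDensity (fun x => ENNReal.ofReal (f x)) with hμ
  have hprob : IsProbabilityMeasure μ := by
    constructor
    rw [hμ, withDensity_apply _ MeasurableSet.univ, Measure.restrict_univ,
      ← ofReal_integral_eq_lintegral_ofReal hfi (Filter.Eventually.of_forall hf0), hf1]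
    simp
  have hIic : ∀ x, μ (Set.Iic x) = ENNReal.ofReal (F x) := by
    intro x
    rw [hμ, withDensity_apply _ measurableSet_Iic, hF,
      ← ofReal_integral_eq_lintegral_ofReal hfi.integrableOn (Filter.Eventually.of_forall hf0)]
  have hF0 : ∀ x, 0 ≤ F x := fun x => by
    rw [hF]; exact integral_nonneg hf0
  have hFcdf : ∀ x, F x = ProbabilityTheory.cdf μ x := by
    intro x
    rw [ProbabilityTheory.cdf_eq_real, measureReal_def, hIic, ENNReal.toReal_ofReal (hF0 x)]
  have hF' : F = ProbabilityTheory.cdf μ := funext hFcdf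
  have hmono : Monotone F := by rw [hF']; exact ProbabilityTheory.monotone_cdf μ
  have hF1 : ∀ x, F x ≤ 1 := fun x => by rw [hF']; exact ProbabilityTheory.cdf_le_one μ x
  have hbot : Filter.Tendsto F Filter.atBot (nhds 0) := by
    rw [hF']; exact ProbabilityTheory.tendsto_cdf_atBot μ
  have htop : Filter.Tendsto F Filter.atTop (nhds 1) := by
    rw [hF']; exact ProbabilityTheory.tendsto_cdf_atTop μ
  have hivt : ∀ t, 0 < t → t < 1 → ∃ x, F x = t := by
    intro t h0 h1
    obtain ⟨a, ha⟩ := (hbot.eventually (gt_mem_nhds h0)).exists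
    obtain ⟨b, hb⟩ := (htop.eventually (lt_mem_nhds h1)).exists
    exact mem_range_of_exists_le_of_exists_ge hFc ⟨a, ha.le⟩ ⟨b, hb.le⟩
  have hm := hFc.measurable
  have hlow : ∀ t, 0 < t → t < 1 → ENNReal.ofReal t ≤ μ (F ⁻¹' Set.Iic t) := by
    intro t h0 h1
    obtain ⟨x, hx⟩ := hivt t h0 h1
    rw [← hx, ← hIic]
    exact measure_mono fun y hy => hmono hy
  have hup' : ∀ t, 0 < t → t < 1 → μ (F ⁻¹' Set.Iio t) ≤ ENNReal.ofReal t := by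
    intro t h0 h1
    obtain ⟨x, hx⟩ := hivt t h0 h1
    rw [← hx, ← hIic]
    refine measure_mono fun y hy => ?_
    by_contra hxy
    exact absurd (hmono (not_le.mp hxy).le) (not_le.mpr hy)
  have hup : ∀ t, t < 1 → μ (F ⁻¹' Set.Iic t) ≤ ENNReal.ofReal t := by
    intro t h1
    have hlim : Filter.Tendsto (fun s => ENNReal.ofReal s) (nhdsWithin (max t 0) (Set.Ioi (max t 0)))
        (nhds (ENNReal.ofReal (max t 0))) :=
      (ENNReal.continuous_ofReal.tendsto _).mono_left nhdsWithin_le_nhds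
    have hmx : ENNReal.ofReal (max t 0) = ENNReal.ofReal t := by
      rcases le_total t 0 with h | h
      · simp [h, ENNReal.ofReal_of_nonpos h]
      · simp [h]
    rw [hmx] at hlim
    refine ge_of_tendsto hlim ?_
    have : max t 0 < 1 := max_lt h1 one_pos
    filter_upwards [Ioo_mem_nhdsGT this] with s hs
    have hst : t < s := (le_max_left _ _).trans_lt hs.1
    refine le_trans (measure_mono ?_) (hup' s ((le_max_right _ _).trans_lt hs.1) hs.2)
    intro y hy
    exact lt_of_le_of_lt hy hst
  have : IsProbabilityMeasure (Measure.map F μ) := Measure.isProbabilityMeasure_map hm.aemeasurable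
  refine Measure.ext_of_Iic _ _ fun t => ?_
  rw [Measure.map_apply hm measurableSet_Iic, Measure.restrict_apply measurableSet_Iic]
  rcases le_or_gt 1 t with h1 | h1
  · have e1 : F ⁻¹' Set.Iic t = Set.univ := by
      ext y; simpa using (hF1 y).trans h1
    have e2 : Set.Iic t ∩ Set.Icc (0:ℝ) 1 = Set.Icc 0 1 :=
      Set.inter_eq_right.mpr fun y hy => hy.2.trans h1
    rw [e1, e2]; simp
  · have e2 : Set.Iic t ∩ Set.Icc (0:ℝ) 1 = Set.Icc 0 t := by
      ext y; simp only [Set.mem_inter_iff, Set.mem_Iic, Set.mem_Icc]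
      constructor
      · rintro ⟨a, b, d⟩; exact ⟨b, a⟩
      · rintro ⟨a, b⟩; exact ⟨b, a, b.trans h1.le⟩
    rw [e2, Real.volume_Icc, sub_zero]
    refine le_antisymm (hup t h1) ?_
    rcases le_or_gt t 0 with h0 | h0
    · rw [ENNReal.ofReal_of_nonpos h0]; exact zero_le
    · exact hlow t h0 h1

lemma aux_tsum (H : ℝ → ENNReal) (hH : Measurable H) :
    ∫⁻ s in Set.Icc (0:ℝ) 1, ∑' k : ℤ, H (s + k) = ∫⁻ s, H s := by
  rw [lintegral_tsum (fun k => by fun_prop)]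
  have h2 : ∫⁻ s, H s = ∑' k : ℤ, ∫⁻ s in Set.Ioc (k:ℝ) (k+1), H s := by
    rw [← setLIntegral_univ, ← iUnion_Ioc_intCast ℝ,
      lintegral_iUnion (fun _ => measurableSet_Ioc) (Set.pairwise_disjoint_Ioc_intCast ℝ)]
  rw [h2]
  congr 1
  funext k
  rw [setLIntegral_congr Ioc_ae_eq_Icc.symm]
  have hmp := measurePreserving_add_right (volume : Measure ℝ) (k:ℝ)
  rw [← hmp.setLIntegral_comp_preimage measurableSet_Ioc hH]
  congr 2
  ext y; simp [add_comm]

lemma aux_enorm_tsum (a : ℤ → ℝ) : ‖∑' k, a k‖ₑ ≤ ∑' k, ‖a k‖ₑ := by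
  by_cases h : Summable a
  · exact enorm_tsum_le_tsum_enorm
  · rw [tsum_eq_zero_of_not_summable h]; simp

lemma aux_main (f g : ℝ → ℝ) (hf : Measurable f) (hg : Measurable g)
    (hf0 : ∀ x, 0 ≤ f x) (hg0 : ∀ x, 0 ≤ g x)
    (hf1 : ∫ x, f x = 1) (hg1 : ∫ x, g x = 1)
    (F G : ℝ → ℝ) (hF : ∀ x, F x = ∫ u in Set.Iic x, f u)
    (hG : ∀ y, G y = ∫ v in Set.Iic y, g v) (φ : ℝ × ℝ → ENNReal) (hφ : Measurable φ) :
    ∫⁻ s, ∫⁻ u, ENNReal.ofReal (f u) * ENNReal.ofReal (g (s - u)) * φ (F u, G (s - u))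
      = ∫⁻ p in Set.Icc (0 : ℝ) 1 ×ˢ Set.Icc (0 : ℝ) 1, φ p := by
  have hFm := (aux_cdf_cont f (aux_integrable f hf1) F hF).measurable
  have hGm := (aux_cdf_cont g (aux_integrable g hg1) G hG).measurable
  rw [lintegral_lintegral_swap (by unfold Function.uncurry; fun_prop)]
  rw [Measure.volume_eq_prod, ← Measure.prod_restrict, lintegral_prod _ hφ.aemeasurable]
  have key : ∫⁻ x in Set.Icc (0:ℝ) 1, ∫⁻ y in Set.Icc (0:ℝ) 1, φ (x, y)
      = ∫⁻ x, ∫⁻ y, φ (x, y) ∂(Measure.map G (volume.withDensity (fun x => ENNReal.ofReal (g x))))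
        ∂(Measure.map F (volume.withDensity (fun x => ENNReal.ofReal (f x)))) := by
    rw [aux_pit f hf hf0 hf1 F hF, aux_pit g hg hg0 hg1 G hG]
  rw [key]
  have hsf : SFinite (Measure.map G (volume.withDensity (fun x => ENNReal.ofReal (g x)))) := by
    rw [aux_pit g hg hg0 hg1 G hG]; infer_instance
  rw [lintegral_map hφ.lintegral_prod_right' hFm,
    lintegral_withDensity_eq_lintegral_mul _ (by fun_prop) (by
      exact hφ.lintegral_prod_right'.comp hFm)]
  refine lintegral_congr fun u => ?_
  rw [lintegral_sub_right_eq_self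
    (fun v => ENNReal.ofReal (f u) * ENNReal.ofReal (g v) * φ (F u, G v)) u]
  simp only [Pi.mul_apply, Function.comp]
  rw [lintegral_map (by fun_prop) hGm,
    lintegral_withDensity_eq_lintegral_mul _ (by fun_prop) (by fun_prop),
    ← lintegral_const_mul _ (by fun_prop)]
  simp [mul_assoc]

/-- Corollary 4.2: with `f, g` probability density functions with CDFs `F, G` and `c` a
copula density on `[0,1]²` with `∫_{[0,1]²} |1 − c| < ∞`, setting
`ε_s = |∑_{k ∈ ℤ} ∫_ℝ f(u) g(s+k−u) (1 − c(F(u), G(s+k−u))) du|`, for every `ε > 0` the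
Lebesgue measure of `{s ∈ [0,1] : ε_s ≥ ε}` is at most `(∫_{[0,1]²} |1 − c|) / ε`. -/
theorem stmt13 (f g : ℝ → ℝ) (hf : Measurable f) (hg : Measurable g)
    (hf0 : ∀ x, 0 ≤ f x) (hg0 : ∀ x, 0 ≤ g x)
    (hf1 : ∫ x, f x = 1) (hg1 : ∫ x, g x = 1)
    (F G : ℝ → ℝ) (hF : ∀ x, F x = ∫ u in Set.Iic x, f u)
    (hG : ∀ y, G y = ∫ v in Set.Iic y, g v)
    (c : ℝ × ℝ → ℝ) (hc : Measurable c) (hc0 : ∀ p, 0 ≤ c p)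
    (hmarg1 : ∀ᵐ u ∂(volume.restrict (Set.Icc (0 : ℝ) 1)),
      ∫ v in (0 : ℝ)..1, c (u, v) = 1)
    (hmarg2 : ∀ᵐ v ∂(volume.restrict (Set.Icc (0 : ℝ) 1)),
      ∫ u in (0 : ℝ)..1, c (u, v) = 1)
    (hcint : IntegrableOn (fun p : ℝ × ℝ => |1 - c p|)
      (Set.Icc (0 : ℝ) 1 ×ˢ Set.Icc (0 : ℝ) 1))
    (ε : ℝ) (hε : 0 < ε) :
    volume {s ∈ Set.Icc (0 : ℝ) 1 |
        ε ≤ |∑' k : ℤ, ∫ u : ℝ, f u * g (s + k - u) * (1 - c (F u, G (s + k - u)))|}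
      ≤ ENNReal.ofReal
          ((∫ p in Set.Icc (0 : ℝ) 1 ×ˢ Set.Icc (0 : ℝ) 1, |1 - c p|) / ε) := by
  have hFm := (aux_cdf_cont f (aux_integrable f hf1) F hF).measurable
  have hGm := (aux_cdf_cont g (aux_integrable g hg1) G hG).measurable
  set φ : ℝ × ℝ → ENNReal := fun p => ‖1 - c p‖ₑ with hφd
  have hφ : Measurable φ := by fun_prop
  set H : ℝ → ENNReal := fun s =>
    ∫⁻ u, ENNReal.ofReal (f u) * ENNReal.ofReal (g (s - u)) * φ (F u, G (s - u)) with hHd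
  have hH : Measurable H := by
    apply Measurable.lintegral_prod_right
    fun_prop
  have hHk : Measurable fun s => ∑' k : ℤ, H (s + k) :=
    Measurable.ennreal_tsum fun k => hH.comp (measurable_id.add_const _)
  have hbound : ∀ s, ‖∑' k : ℤ, ∫ u : ℝ, f u * g (s + k - u) * (1 - c (F u, G (s + k - u)))‖ₑ
      ≤ ∑' k : ℤ, H (s + k) := by
    intro s
    refine (aux_enorm_tsum _).trans (ENNReal.tsum_le_tsum fun k => ?_)
    refine (enorm_integral_le_lintegral_enorm _).trans (le_of_eq ?_)
    refine lintegral_congr fun u => ?_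
    rw [enorm_mul, enorm_mul, Real.enorm_of_nonneg (hf0 _), Real.enorm_of_nonneg (hg0 _)]
  have htot : ∫⁻ s in Set.Icc (0:ℝ) 1, ∑' k : ℤ, H (s + k)
      = ENNReal.ofReal (∫ p in Set.Icc (0 : ℝ) 1 ×ˢ Set.Icc (0 : ℝ) 1, |1 - c p|) := by
    rw [aux_tsum H hH, aux_main f g hf hg hf0 hg0 hf1 hg1 F G hF hG φ hφ,
      ofReal_integral_eq_lintegral_ofReal hcint (Filter.Eventually.of_forall fun _ => abs_nonneg _)]
    refine lintegral_congr fun p => ?_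
    rw [hφd, ← Real.norm_eq_abs, ofReal_norm]
  rw [ENNReal.ofReal_div_of_pos hε, ← htot]
  refine le_trans ?_ (meas_ge_le_lintegral_div hHk.aemeasurable
    (ENNReal.ofReal_pos.mpr hε).ne' ENNReal.ofReal_ne_top)
  rw [Measure.restrict_apply (measurableSet_le measurable_const hHk)]
  refine measure_mono ?_
  rintro s ⟨hs, hle⟩
  refine ⟨?_, hs⟩
  refine le_trans ?_ (hbound s)
  rw [← ofReal_norm, Real.norm_eq_abs]
  exact ENNReal.ofReal_le_ofReal hle
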